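/- arXiv:1103.1034 — 2 statements merged into one kernel-verified Lean document; each statement's English description precedes it below -/
import Mathlib

section
/- Let f belong to CW²_Δ[−1,1] with constant M₂. Then for every x ∈ (−1,1) the Cauchy principal value R_N(f,x) = J(f − S_N, x) exists and satisfies |R_N(f,x)| ≤ (γ²M₂/π)·(1 + π√2/(γ·ln N))·(ln N)/N². -/
open Real MeasureTheory Filter Topology

/-- The denominator occurring in the primitive of the Cauchy kernel with Chebyshev weight. -/
noncomputable def chebyshevDenom (x u : ℝ) : ℝ :=
  1 - x * u + √(1 - x ^ 2) * √(1 - u ^ 2)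

/-- A primitive of `u ↦ √(1 - x ^ 2) / (√(1 - u ^ 2) * (u - x))` away from `x`. -/
noncomputable def chebyshevPrimitive (x u : ℝ) : ℝ :=
  log (u - x) - log (chebyshevDenom x u)

lemma continuous_chebyshevDenom (x : ℝ) : Continuous (chebyshevDenom x) := by
  unfold chebyshevDenom
  fun_prop

lemma chebyshevDenom_pos {x u : ℝ} (hx : x ∈ Set.Ioo (-1 : ℝ) 1) (hu : u ∈ Set.Icc (-1 : ℝ) 1) :
    0 < chebyshevDenom x u := by
  have h1 : 0 ≤ √(1 - x ^ 2) * √(1 - u ^ 2) := by positivity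
  have h2 : 0 < 1 - x * u := by
    have hxu : |x| * |u| ≤ |x| * 1 := by gcongr; exact abs_le.2 hu
    linarith [le_abs_self (x * u), abs_mul x u, abs_lt.2 hx]
  unfold chebyshevDenom
  linarith

lemma chebyshevPrimitive_one (x : ℝ) : chebyshevPrimitive x 1 = 0 := by
  simp [chebyshevPrimitive, chebyshevDenom]

lemma chebyshevPrimitive_neg_one (x : ℝ) : chebyshevPrimitive x (-1) = 0 := by
  have h : (-1 : ℝ) - x = -(1 + x) := by ring
  rw [chebyshevPrimitive, h, log_neg_eq_log]
  simp [chebyshevDenom]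

lemma sqrt_one_sub_sq_pos {u : ℝ} (hu : u ∈ Set.Ioo (-1 : ℝ) 1) : 0 < √(1 - u ^ 2) :=
  sqrt_pos.2 (by nlinarith [hu.1, hu.2])

lemma hasDerivAt_chebyshevPrimitive {x u : ℝ} (hx : x ∈ Set.Ioo (-1 : ℝ) 1)
    (hu : u ∈ Set.Ioo (-1 : ℝ) 1) (hux : u ≠ x) :
    HasDerivAt (chebyshevPrimitive x) (√(1 - x ^ 2) / (√(1 - u ^ 2) * (u - x))) u := by
  have hD := chebyshevDenom_pos hx (Set.Ioo_subset_Icc_self hu)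
  have hw := sqrt_one_sub_sq_pos hu
  have hsub : u - x ≠ 0 := sub_ne_zero.2 hux
  have hu2 : (1 : ℝ) - u ^ 2 ≠ 0 := by nlinarith [hu.1, hu.2]
  have hws : √(1 - u ^ 2) ^ 2 = 1 - u ^ 2 := sq_sqrt (by nlinarith [hu.1, hu.2])
  have hss : √(1 - x ^ 2) ^ 2 = 1 - x ^ 2 := sq_sqrt (by nlinarith [hx.1, hx.2])
  have d1 : HasDerivAt (fun v : ℝ => log (v - x)) (1 / (u - x)) u :=
    ((hasDerivAt_id u).sub_const x).log hsub
  have d2 : HasDerivAt (chebyshevDenom x)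
      (-x + √(1 - x ^ 2) * (-(2 * u) / (2 * √(1 - u ^ 2)))) u := by
    have e1 : HasDerivAt (fun v : ℝ => 1 - x * v) (-x) u := by
      simpa using ((hasDerivAt_id u).const_mul x).const_sub 1
    have e2 : HasDerivAt (fun v : ℝ => 1 - v ^ 2) (-(2 * u)) u := by
      simpa using (hasDerivAt_pow 2 u).const_sub 1
    exact e1.add ((e2.sqrt hu2).const_mul _)
  refine (d1.sub (d2.log hD.ne')).congr_deriv ?_
  have hDe : chebyshevDenom x u = 1 - x * u + √(1 - x ^ 2) * √(1 - u ^ 2) := rfl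
  generalize chebyshevDenom x u = D at *
  generalize √(1 - x ^ 2) = s at *
  generalize √(1 - u ^ 2) = w at *
  field_simp
  linear_combination s * hws - w * hss + (w - s) * hDe

lemma intervalIntegrable_inv_sqrt_one_sub_sq {a b : ℝ} (ha : a ∈ Set.Icc (-1 : ℝ) 1)
    (hb : b ∈ Set.Icc (-1 : ℝ) 1) :
    IntervalIntegrable (fun u : ℝ => 1 / √(1 - u ^ 2)) volume a b := by
  have h : IntervalIntegrable (fun u : ℝ => 1 / √(1 - u ^ 2)) volume (-1) 1 := by
    refine intervalIntegral.intervalIntegrable_deriv_of_nonneg continuous_arcsin.continuousOn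
      (fun u hu => ?_) (fun u _ => by positivity)
    norm_num at hu
    exact hasDerivAt_arcsin hu.1.ne' hu.2.ne
  refine h.mono_set ?_
  rw [Set.uIcc_of_le (by norm_num : (-1 : ℝ) ≤ 1)]
  exact Set.uIcc_subset_Icc ha hb

lemma integral_inv_sqrt_one_sub_sq {a b : ℝ} (ha : -1 ≤ a) (hab : a ≤ b) (hb : b ≤ 1) :
    ∫ u in a..b, 1 / √(1 - u ^ 2) = arccos a - arccos b := by
  rw [intervalIntegral.integral_eq_sub_of_hasDerivAt_of_le hab continuous_arcsin.continuousOn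
    (fun u hu => hasDerivAt_arcsin (by linarith [hu.1] : (-1 : ℝ) < u).ne'
      (by linarith [hu.2] : u < 1).ne)
    (intervalIntegrable_inv_sqrt_one_sub_sq ⟨ha, by linarith⟩ ⟨by linarith, hb⟩)]
  simp only [arccos]
  ring

lemma intervalIntegrable_chebyshevKernel {x a b : ℝ} (c : ℝ) (ha : -1 ≤ a) (hab : a ≤ b)
    (hb : b ≤ 1) (hxab : x ∉ Set.Icc a b) :
    IntervalIntegrable (fun u => c / (√(1 - u ^ 2) * (u - x))) volume a b := by
  have h := (intervalIntegrable_inv_sqrt_one_sub_sq (a := a) (b := b) ⟨ha, by linarith⟩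
    ⟨by linarith, hb⟩).mul_continuousOn (g := fun u => c / (u - x)) ?_
  · refine h.congr fun u _ => ?_
    simp only [div_mul_div_comm, one_mul]
  · rw [Set.uIcc_of_le hab]
    exact continuousOn_const.div (by fun_prop)
      fun u hu => sub_ne_zero.2 fun h => hxab (h ▸ hu)

lemma integral_chebyshevKernel {x a b : ℝ} (hx : x ∈ Set.Ioo (-1 : ℝ) 1) (ha : -1 ≤ a)
    (hab : a ≤ b) (hb : b ≤ 1) (hxab : x ∉ Set.Icc a b) :
    ∫ u in a..b, √(1 - x ^ 2) / (√(1 - u ^ 2) * (u - x)) =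
      chebyshevPrimitive x b - chebyshevPrimitive x a := by
  refine intervalIntegral.integral_eq_sub_of_hasDerivAt_of_le hab ?_ (fun u hu => ?_)
    (intervalIntegrable_chebyshevKernel _ ha hab hb hxab)
  · refine ContinuousOn.sub (ContinuousOn.log (by fun_prop) fun u hu => ?_)
      (ContinuousOn.log (continuous_chebyshevDenom x).continuousOn fun u hu => ?_)
    · exact sub_ne_zero.2 fun h => hxab (h ▸ hu)
    · exact (chebyshevDenom_pos hx ⟨ha.trans hu.1, hu.2.trans hb⟩).ne'
  · exact hasDerivAt_chebyshevPrimitive hx ⟨ha.trans_lt hu.1, hu.2.trans_le hb⟩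
      fun h => hxab (h ▸ Set.Ioo_subset_Icc_self hu)

lemma neg_chebyshevPrimitive_cos_le {φ θ δ : ℝ} (hφ : φ ∈ Set.Ioo 0 π) (hθ : θ ∈ Set.Icc 0 π)
    (hδ : 0 < δ) (hd : |φ - θ| = δ) :
    -chebyshevPrimitive (cos φ) (cos θ) ≤ log (π / δ) := by
  have hδπ : δ ≤ π := by
    rw [← hd, abs_le]
    constructor <;> linarith [hφ.1, hφ.2, hθ.1, hθ.2]
  set p := sin ((φ + θ) / 2) with hp
  have hp0 : 0 < p := sin_pos_of_pos_of_lt_pi (by linarith [hφ.1, hθ.1])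
    (by linarith [hφ.2, hθ.2])
  have hp1 : p ≤ 1 := sin_le_one _
  have hD : chebyshevDenom (cos φ) (cos θ) = 2 * p ^ 2 := by
    have h1 : √(1 - cos φ ^ 2) = sin φ := by
      rw [← sin_sq, sqrt_sq (sin_nonneg_of_nonneg_of_le_pi hφ.1.le hφ.2.le)]
    have h2 : √(1 - cos θ ^ 2) = sin θ := by
      rw [← sin_sq, sqrt_sq (sin_nonneg_of_nonneg_of_le_pi hθ.1 hθ.2)]
    have h3 := cos_add φ θ
    have h4 := cos_sq ((φ + θ) / 2)
    rw [mul_div_cancel₀ _ two_ne_zero] at h4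
    have h5 := sin_sq_add_cos_sq ((φ + θ) / 2)
    rw [chebyshevDenom, h1, h2]
    linarith
  have hq : δ / π ≤ sin (δ / 2) := by
    have := mul_le_sin (x := δ / 2) (by linarith) (by linarith)
    calc δ / π = 2 / π * (δ / 2) := by ring
      _ ≤ _ := this
  have hq0 : 0 < sin (δ / 2) := lt_of_lt_of_le (by positivity) hq
  have hdist : |cos θ - cos φ| = 2 * p * sin (δ / 2) := by
    have habs : |sin ((θ - φ) / 2)| = sin (δ / 2) := by
      rcases abs_cases (φ - θ) with ⟨h, _⟩ | ⟨h, _⟩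
      · rw [show (θ - φ) / 2 = -(δ / 2) by linarith, sin_neg, abs_neg, abs_of_pos (by linarith)]
      · rw [show (θ - φ) / 2 = δ / 2 by linarith, abs_of_pos (by linarith)]
    rw [cos_sub_cos, abs_mul, habs, abs_mul, add_comm θ φ, ← hp, abs_of_pos hp0]
    norm_num
  rw [chebyshevPrimitive, neg_sub, ← log_abs (cos θ - cos φ), hD, hdist,
    ← log_div (by positivity) (by positivity)]
  refine log_le_log (by positivity) ?_
  rw [div_le_div_iff₀ (by positivity) hδ]
  have hq' : δ ≤ π * sin (δ / 2) := by
    rwa [div_le_iff₀' pi_pos] at hq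
  calc 2 * p ^ 2 * δ ≤ 2 * p ^ 2 * (π * sin (δ / 2)) := by gcongr
    _ = (2 * p * (π * sin (δ / 2))) * p := by ring
    _ ≤ (2 * p * (π * sin (δ / 2))) * 1 := by gcongr
    _ = π * (2 * p * sin (δ / 2)) := by ring

/-- The regularized Cauchy kernel applied to `e`. -/
noncomputable def chebyshevQuotient (e : ℝ → ℝ) (x u : ℝ) : ℝ :=
  (e u - e x) / (√(1 - u ^ 2) * (u - x))

section LipschitzDensity

variable {e : ℝ → ℝ} {L : ℝ} {x : ℝ}

lemma abs_chebyshevQuotient_le (hx : x ∈ Set.Ioo (-1 : ℝ) 1) (hL : 0 ≤ L)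
    (he : ∀ u ∈ Set.Icc (-1 : ℝ) 1, ∀ v ∈ Set.Icc (-1 : ℝ) 1, |e u - e v| ≤ L * |u - v|)
    {u : ℝ} (hu : u ∈ Set.Icc (-1 : ℝ) 1) :
    |chebyshevQuotient e x u| ≤ L * (1 / √(1 - u ^ 2)) := by
  rw [chebyshevQuotient, mul_comm, ← div_div, div_eq_mul_one_div _ (√(1 - u ^ 2)), abs_mul,
    abs_of_nonneg (by positivity : 0 ≤ 1 / √(1 - u ^ 2)), abs_div]
  gcongr
  exact div_le_of_le_mul₀ (abs_nonneg _) hL (he u hu x (Set.Ioo_subset_Icc_self hx))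

lemma intervalIntegrable_chebyshevQuotient (hx : x ∈ Set.Ioo (-1 : ℝ) 1) (hL : 0 ≤ L)
    (he : ∀ u ∈ Set.Icc (-1 : ℝ) 1, ∀ v ∈ Set.Icc (-1 : ℝ) 1, |e u - e v| ≤ L * |u - v|)
    {a b : ℝ} (ha : a ∈ Set.Icc (-1 : ℝ) 1) (hb : b ∈ Set.Icc (-1 : ℝ) 1) :
    IntervalIntegrable (chebyshevQuotient e x) volume a b := by
  have hsub : Set.uIoc a b ⊆ Set.Icc (-1 : ℝ) 1 :=
    Set.uIoc_subset_uIcc.trans (Set.uIcc_subset_Icc ha hb)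
  have hec : ContinuousOn e (Set.Icc (-1 : ℝ) 1) :=
    (LipschitzOnWith.of_dist_le_mul (K := ⟨L, hL⟩) fun u hu v hv => he u hu v hv).continuousOn
  refine ((intervalIntegrable_inv_sqrt_one_sub_sq ha hb).const_mul L).mono_fun' ?_ ?_
  · have hm : AEMeasurable e (volume.restrict (Set.uIoc a b)) :=
      (hec.mono hsub).aemeasurable measurableSet_uIoc
    exact ((hm.sub_const _).div (by fun_prop)).aestronglyMeasurable
  · filter_upwards [ae_restrict_mem measurableSet_uIoc] with u hu
    exact abs_chebyshevQuotient_le hx hL he (hsub hu)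

lemma integral_chebyshevKernel_mul (hx : x ∈ Set.Ioo (-1 : ℝ) 1) (hL : 0 ≤ L)
    (he : ∀ u ∈ Set.Icc (-1 : ℝ) 1, ∀ v ∈ Set.Icc (-1 : ℝ) 1, |e u - e v| ≤ L * |u - v|)
    {a b : ℝ} (ha : -1 ≤ a) (hab : a ≤ b) (hb : b ≤ 1) (hxab : x ∉ Set.Icc a b) :
    ∫ u in a..b, e u / (√(1 - u ^ 2) * (u - x)) =
      (∫ u in a..b, chebyshevQuotient e x u) +
        e x / √(1 - x ^ 2) * (chebyshevPrimitive x b - chebyshevPrimitive x a) := by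
  have hs := sqrt_one_sub_sq_pos hx
  rw [← integral_chebyshevKernel hx ha hab hb hxab, ← intervalIntegral.integral_const_mul,
    ← intervalIntegral.integral_add
      (intervalIntegrable_chebyshevQuotient hx hL he ⟨ha, hab.trans hb⟩ ⟨ha.trans hab, hb⟩)
      ((intervalIntegrable_chebyshevKernel _ ha hab hb hxab).const_mul _)]
  refine intervalIntegral.integral_congr fun u _ => ?_
  simp only [chebyshevQuotient]
  rw [← mul_div_assoc, div_mul_cancel₀ _ hs.ne', ← add_div, sub_add_cancel]

/-- For a Lipschitz density the principal value is the integral of the regularized kernel. -/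
lemma tendsto_chebyshev_principalValue (hx : x ∈ Set.Ioo (-1 : ℝ) 1) (hL : 0 ≤ L)
    (he : ∀ u ∈ Set.Icc (-1 : ℝ) 1, ∀ v ∈ Set.Icc (-1 : ℝ) 1, |e u - e v| ≤ L * |u - v|) :
    Tendsto (fun ε : ℝ =>
        (∫ u in (-1 : ℝ)..(x - ε), e u / (√(1 - u ^ 2) * (u - x))) +
          ∫ u in (x + ε)..(1 : ℝ), e u / (√(1 - u ^ 2) * (u - x)))
      (𝓝[>] (0 : ℝ)) (𝓝 (∫ u in (-1 : ℝ)..1, chebyshevQuotient e x u)) := by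
  have hxI := Set.Ioo_subset_Icc_self hx
  have h1 : (-1 : ℝ) ∈ Set.Icc (-1 : ℝ) 1 := by norm_num
  have h2 : (1 : ℝ) ∈ Set.Icc (-1 : ℝ) 1 := by norm_num
  have hint {a b : ℝ} (ha : a ∈ Set.Icc (-1 : ℝ) 1) (hb : b ∈ Set.Icc (-1 : ℝ) 1) :
      IntervalIntegrable (chebyshevQuotient e x) volume a b :=
    intervalIntegrable_chebyshevQuotient hx hL he ha hb
  set P : ℝ → ℝ := fun y => ∫ u in (-1 : ℝ)..y, chebyshevQuotient e x u with hP
  have hPc : ContinuousAt P x := by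
    have := intervalIntegral.continuousOn_primitive_interval' (hint h1 h2)
      (Set.left_mem_uIcc)
    rw [Set.uIcc_of_le (by norm_num : (-1 : ℝ) ≤ 1)] at this
    exact this.continuousAt (Icc_mem_nhds hx.1 hx.2)
  have hDc : ContinuousAt (fun y => log (chebyshevDenom x y)) x :=
    (continuous_chebyshevDenom x).continuousAt.log (chebyshevDenom_pos hx hxI).ne'
  have hsub : Tendsto (fun ε : ℝ => x - ε) (𝓝[>] 0) (𝓝 x) := by
    have : Tendsto (fun ε : ℝ => x - ε) (𝓝 0) (𝓝 (x - 0)) := by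
      exact (continuous_const.sub continuous_id).tendsto 0
    rw [sub_zero] at this
    exact this.mono_left nhdsWithin_le_nhds
  have hadd : Tendsto (fun ε : ℝ => x + ε) (𝓝[>] 0) (𝓝 x) := by
    have : Tendsto (fun ε : ℝ => x + ε) (𝓝 0) (𝓝 (x + 0)) := by
      exact (continuous_const.add continuous_id).tendsto 0
    rw [add_zero] at this
    exact this.mono_left nhdsWithin_le_nhds
  have hlim : Tendsto (fun ε : ℝ => (P (x - ε) + (P 1 - P (x + ε))) + e x / √(1 - x ^ 2) *
      (log (chebyshevDenom x (x + ε)) - log (chebyshevDenom x (x - ε)))) (𝓝[>] 0)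
      (𝓝 (P 1)) := by
    have := ((hPc.tendsto.comp hsub).add ((hPc.tendsto.comp hadd).const_sub (P 1))).add
      (((hDc.tendsto.comp hadd).sub (hDc.tendsto.comp hsub)).const_mul (e x / √(1 - x ^ 2)))
    simpa only [Function.comp_apply, add_sub_cancel, sub_self, mul_zero, add_zero] using this
  refine hlim.congr' ?_
  have hpos : 0 < min (x + 1) (1 - x) := lt_min (by linarith [hx.1]) (by linarith [hx.2])
  filter_upwards [Ioo_mem_nhdsGT hpos] with ε hε
  have hε1 := hε.2.trans_le (min_le_left _ _)
  have hε2 := hε.2.trans_le (min_le_right _ _)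
  have hε0 := hε.1
  rw [integral_chebyshevKernel_mul hx hL he le_rfl (by linarith) (by linarith [hx.2])
      (fun h => by linarith [h.2]),
    integral_chebyshevKernel_mul hx hL he (by linarith [hx.1]) (by linarith) le_rfl
      (fun h => by linarith [h.1]),
    chebyshevPrimitive_one, chebyshevPrimitive_neg_one]
  have hP1 : P 1 = P (x + ε) + ∫ u in (x + ε)..1, chebyshevQuotient e x u :=
    (intervalIntegral.integral_add_adjacent_intervals
      (hint h1 ⟨by linarith [hx.1], by linarith⟩)
      (hint ⟨by linarith [hx.1], by linarith⟩ h2)).symm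
  rw [hP1]
  have hl : log (x - ε - x) = log (x + ε - x) := by
    rw [show x - ε - x = -(x + ε - x) by ring, log_neg_eq_log]
  simp only [chebyshevPrimitive, hl, hP]
  ring

lemma abs_integral_chebyshevQuotient_le_of_right (hx : x ∈ Set.Ioo (-1 : ℝ) 1) {E : ℝ}
    (hE : ∀ u ∈ Set.Icc (-1 : ℝ) 1, |e u| ≤ E) {b : ℝ} (hxb : x < b) (hb : b ≤ 1) :
    √(1 - x ^ 2) * |∫ u in b..1, chebyshevQuotient e x u| ≤
      2 * E * -chebyshevPrimitive x b := by
  have hb1 : -1 ≤ b := by linarith [hx.1]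
  have hxn : x ∉ Set.Icc b 1 := fun h => by linarith [h.1]
  have hs := sqrt_one_sub_sq_pos hx
  have key : |∫ u in b..1, chebyshevQuotient e x u| ≤
      ∫ u in b..1, 2 * E / √(1 - x ^ 2) * (√(1 - x ^ 2) / (√(1 - u ^ 2) * (u - x))) := by
    rw [← norm_eq_abs]
    refine intervalIntegral.norm_integral_le_of_norm_le hb (ae_of_all _ fun u hu => ?_)
      ((intervalIntegrable_chebyshevKernel _ hb1 hb le_rfl hxn).const_mul _)
    have hden : 0 ≤ √(1 - u ^ 2) * (u - x) :=
      mul_nonneg (sqrt_nonneg _) (by linarith [hu.1])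
    have h1 := abs_le.1 (hE u ⟨by linarith [hu.1], hu.2⟩)
    have h2 := abs_le.1 (hE x (Set.Ioo_subset_Icc_self hx))
    rw [← mul_div_assoc, div_mul_cancel₀ _ hs.ne', chebyshevQuotient, norm_eq_abs, abs_div,
      abs_of_nonneg hden]
    gcongr
    rw [abs_le]
    constructor <;> linarith
  rw [intervalIntegral.integral_const_mul, integral_chebyshevKernel hx hb1 hb le_rfl hxn,
    chebyshevPrimitive_one, zero_sub, div_mul_eq_mul_div, le_div_iff₀' hs] at key
  exact key

lemma abs_integral_chebyshevQuotient_le_of_left (hx : x ∈ Set.Ioo (-1 : ℝ) 1) {E : ℝ}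
    (hE : ∀ u ∈ Set.Icc (-1 : ℝ) 1, |e u| ≤ E) {a : ℝ} (ha : -1 ≤ a) (hax : a < x) :
    √(1 - x ^ 2) * |∫ u in (-1 : ℝ)..a, chebyshevQuotient e x u| ≤
      2 * E * -chebyshevPrimitive x a := by
  have ha1 : a ≤ 1 := by linarith [hx.2]
  have hxn : x ∉ Set.Icc (-1) a := fun h => by linarith [h.2]
  have hs := sqrt_one_sub_sq_pos hx
  have key : |∫ u in (-1 : ℝ)..a, chebyshevQuotient e x u| ≤
      ∫ u in (-1 : ℝ)..a,
        -(2 * E / √(1 - x ^ 2)) * (√(1 - x ^ 2) / (√(1 - u ^ 2) * (u - x))) := by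
    rw [← norm_eq_abs]
    refine intervalIntegral.norm_integral_le_of_norm_le ha (ae_of_all _ fun u hu => ?_)
      ((intervalIntegrable_chebyshevKernel _ le_rfl ha ha1 hxn).const_mul _)
    have hden : √(1 - u ^ 2) * (u - x) ≤ 0 :=
      mul_nonpos_of_nonneg_of_nonpos (sqrt_nonneg _) (by linarith [hu.2])
    have h1 := abs_le.1 (hE u ⟨hu.1.le, by linarith [hu.2]⟩)
    have h2 := abs_le.1 (hE x (Set.Ioo_subset_Icc_self hx))
    rw [neg_mul, ← mul_div_assoc, div_mul_cancel₀ _ hs.ne', chebyshevQuotient, norm_eq_abs,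
      abs_div, abs_of_nonpos hden, ← div_neg]
    have hden' : 0 ≤ -(√(1 - u ^ 2) * (u - x)) := neg_nonneg.2 hden
    gcongr
    rw [abs_le]
    constructor <;> linarith
  rw [intervalIntegral.integral_const_mul, integral_chebyshevKernel hx le_rfl ha ha1 hxn,
    chebyshevPrimitive_neg_one, sub_zero, neg_mul_comm, div_mul_eq_mul_div,
    le_div_iff₀' hs] at key
  exact key

lemma abs_integral_chebyshevQuotient_le_arccos (hx : x ∈ Set.Ioo (-1 : ℝ) 1) (hL : 0 ≤ L)
    (he : ∀ u ∈ Set.Icc (-1 : ℝ) 1, ∀ v ∈ Set.Icc (-1 : ℝ) 1, |e u - e v| ≤ L * |u - v|)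
    {a b : ℝ} (ha : -1 ≤ a) (hab : a ≤ b) (hb : b ≤ 1) :
    √(1 - x ^ 2) * |∫ u in a..b, chebyshevQuotient e x u| ≤ L * (arccos a - arccos b) := by
  have key : |∫ u in a..b, chebyshevQuotient e x u| ≤ ∫ u in a..b, L * (1 / √(1 - u ^ 2)) := by
    rw [← norm_eq_abs]
    exact intervalIntegral.norm_integral_le_of_norm_le hab
      (ae_of_all _ fun u hu =>
        abs_chebyshevQuotient_le hx hL he ⟨ha.trans hu.1.le, hu.2.trans hb⟩)
      ((intervalIntegrable_inv_sqrt_one_sub_sq ⟨ha, hab.trans hb⟩ ⟨ha.trans hab, hb⟩).const_mul L)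
  rw [intervalIntegral.integral_const_mul, integral_inv_sqrt_one_sub_sq ha hab hb] at key
  have hs : √(1 - x ^ 2) ≤ 1 := sqrt_le_one.2 (by nlinarith)
  calc _ ≤ 1 * |∫ u in a..b, chebyshevQuotient e x u| := by gcongr
    _ ≤ _ := by rwa [one_mul]

lemma abs_integral_chebyshevQuotient_le (hx : x ∈ Set.Ioo (-1 : ℝ) 1) (hL : 0 ≤ L)
    (he : ∀ u ∈ Set.Icc (-1 : ℝ) 1, ∀ v ∈ Set.Icc (-1 : ℝ) 1, |e u - e v| ≤ L * |u - v|)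
    {E δ : ℝ} (hE : ∀ u ∈ Set.Icc (-1 : ℝ) 1, |e u| ≤ E) (hδ : 0 < δ) (hδπ : δ ≤ π) :
    √(1 - x ^ 2) * |∫ u in (-1 : ℝ)..1, chebyshevQuotient e x u| ≤
      2 * L * δ + 4 * E * log (π / δ) := by
  have hE0 : 0 ≤ E := (abs_nonneg _).trans (hE x (Set.Ioo_subset_Icc_self hx))
  set φ := arccos x
  have hcos : cos φ = x := cos_arccos hx.1.le hx.2.le
  have hφ : φ ∈ Set.Ioo 0 π := by
    refine ⟨arccos_pos.2 hx.2, (arccos_le_pi x).lt_of_ne fun h : φ = π => hx.1.ne ?_⟩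
    rw [← hcos, h, cos_pi]
  have hlog : 0 ≤ log (π / δ) := log_nonneg ((one_le_div hδ).2 hδπ)
  obtain ⟨α, hα, hφα, hαδ, hα'⟩ : ∃ α ∈ Set.Icc 0 π, φ < α ∧ α ≤ φ + δ ∧
      -chebyshevPrimitive x (cos α) ≤ log (π / δ) := by
    rcases le_total π (φ + δ) with h | h
    · refine ⟨π, ⟨pi_pos.le, le_rfl⟩, hφ.2, h, ?_⟩
      rwa [cos_pi, chebyshevPrimitive_neg_one, neg_zero]
    · have hm : φ + δ ∈ Set.Icc 0 π := ⟨by linarith [hφ.1], h⟩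
      refine ⟨φ + δ, hm, by linarith, le_rfl, ?_⟩
      rw [← hcos]
      exact neg_chebyshevPrimitive_cos_le hφ hm hδ (by simp [abs_of_pos hδ])
  obtain ⟨β, hβ, hφβ, hβδ, hβ'⟩ : ∃ β ∈ Set.Icc 0 π, β < φ ∧ φ - δ ≤ β ∧
      -chebyshevPrimitive x (cos β) ≤ log (π / δ) := by
    rcases le_total (φ - δ) 0 with h | h
    · refine ⟨0, ⟨le_rfl, pi_pos.le⟩, hφ.1, h, ?_⟩
      rwa [cos_zero, chebyshevPrimitive_one, neg_zero]
    · have hm : φ - δ ∈ Set.Icc 0 π := ⟨h, by linarith [hφ.2]⟩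
      refine ⟨φ - δ, hm, by linarith, le_rfl, ?_⟩
      rw [← hcos]
      exact neg_chebyshevPrimitive_cos_le hφ hm hδ (by simp [abs_of_pos hδ])
  have hax : cos α < x := hcos ▸ cos_lt_cos_of_nonneg_of_le_pi hφ.1.le hα.2 hφα
  have hxb : x < cos β := by
    conv_lhs => rw [← hcos]
    exact cos_lt_cos_of_nonneg_of_le_pi hβ.1 hφ.2.le hφβ
  have hint {a b : ℝ} (ha : a ∈ Set.Icc (-1 : ℝ) 1) (hb : b ∈ Set.Icc (-1 : ℝ) 1) :
      IntervalIntegrable (chebyshevQuotient e x) volume a b :=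
    intervalIntegrable_chebyshevQuotient hx hL he ha hb
  have h1 : (-1 : ℝ) ∈ Set.Icc (-1 : ℝ) 1 := by norm_num
  have h2 : (1 : ℝ) ∈ Set.Icc (-1 : ℝ) 1 := by norm_num
  have hmid := abs_integral_chebyshevQuotient_le_arccos hx hL he (neg_one_le_cos α)
    (hax.trans hxb).le (cos_le_one β)
  rw [arccos_cos hα.1 hα.2, arccos_cos hβ.1 hβ.2] at hmid
  have hleft := abs_integral_chebyshevQuotient_le_of_left hx hE (neg_one_le_cos α) hax
  have hright := abs_integral_chebyshevQuotient_le_of_right hx hE hxb (cos_le_one β)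
  have hsplit : ∫ u in (-1 : ℝ)..1, chebyshevQuotient e x u =
      (∫ u in (-1 : ℝ)..cos α, chebyshevQuotient e x u) +
        (∫ u in cos α..cos β, chebyshevQuotient e x u) +
          ∫ u in cos β..1, chebyshevQuotient e x u := by
    rw [intervalIntegral.integral_add_adjacent_intervals (hint h1 (cos_mem_Icc α))
        (hint (cos_mem_Icc α) (cos_mem_Icc β)),
      intervalIntegral.integral_add_adjacent_intervals (hint h1 (cos_mem_Icc β))
        (hint (cos_mem_Icc β) h2)]
  rw [hsplit]
  have hαβ : L * (α - β) ≤ L * (2 * δ) := by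
    gcongr
    linarith
  have hα2 : 2 * E * -chebyshevPrimitive x (cos α) ≤ 2 * E * log (π / δ) := by gcongr
  have hβ2 : 2 * E * -chebyshevPrimitive x (cos β) ≤ 2 * E * log (π / δ) := by gcongr
  have htri := mul_le_mul_of_nonneg_left
    (abs_add_three (∫ u in (-1 : ℝ)..cos α, chebyshevQuotient e x u)
      (∫ u in cos α..cos β, chebyshevQuotient e x u)
      (∫ u in cos β..1, chebyshevQuotient e x u)) (sqrt_nonneg (1 - x ^ 2))
  linarith

end LipschitzDensity

section LinearInterpolation

variable {f g : ℝ → ℝ} {M a b : ℝ}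

lemma le_of_hasDerivWithinAt_lipschitz_of_endpoints_eq_zero {e p : ℝ → ℝ} (hab : a < b)
    (hd : ∀ u ∈ Set.Icc a b, HasDerivWithinAt e (p u) (Set.Icc a b) u)
    (hp : ∀ u ∈ Set.Icc a b, ∀ v ∈ Set.Icc a b, |p u - p v| ≤ M * |u - v|)
    (ha : e a = 0) (hb : e b = 0) {u : ℝ} (hu : u ∈ Set.Icc a b) :
    e u ≤ M / 2 * ((u - a) * (b - u)) := by
  have hint (v : ℝ) (hv : v ∈ Set.Ioo a b) :
      HasDerivAt (fun v => e v + M / 2 * ((v - a) * (v - b)))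
        (p v + M / 2 * ((v - b) + (v - a))) v := by
    have h1 := (hd v (Set.Ioo_subset_Icc_self hv)).hasDerivAt (Icc_mem_nhds hv.1 hv.2)
    have h2 := ((hasDerivAt_id v).sub_const a).mul ((hasDerivAt_id v).sub_const b)
    exact h1.add ((h2.congr_deriv (by simp)).const_mul (M / 2))
  have hconv : ConvexOn ℝ (Set.Icc a b) (fun v => e v + M / 2 * ((v - a) * (v - b))) := by
    refine MonotoneOn.convexOn_of_deriv (convex_Icc a b) ?_ ?_ ?_
    · exact ContinuousOn.add (fun v hv => (hd v hv).continuousWithinAt) (by fun_prop)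
    · rw [interior_Icc]
      exact fun v hv => (hint v hv).differentiableAt.differentiableWithinAt
    · rw [interior_Icc]
      intro v hv w hw hvw
      rw [(hint v hv).deriv, (hint w hw).deriv]
      have h := (le_abs_self _).trans
        (hp v (Set.Ioo_subset_Icc_self hv) w (Set.Ioo_subset_Icc_self hw))
      rw [abs_sub_comm, abs_of_nonneg (sub_nonneg.2 hvw)] at h
      linarith
  have h := hconv.le_max_of_mem_Icc (Set.left_mem_Icc.2 hab.le) (Set.right_mem_Icc.2 hab.le) hu
  simp only [ha, hb, sub_self, zero_mul, mul_zero, add_zero, max_self] at h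
  linarith

/-- The linear interpolant of `f` at the nodes `a` and `b`. -/
noncomputable def linearInterpolant (f : ℝ → ℝ) (a b u : ℝ) : ℝ :=
  ((b - u) * f a + (u - a) * f b) / (b - a)

lemma hasDerivAt_linearInterpolant (f : ℝ → ℝ) (a b u : ℝ) :
    HasDerivAt (linearInterpolant f a b) ((f b - f a) / (b - a)) u := by
  have h1 : HasDerivAt (fun u => (b - u) * f a) (-1 * f a) u :=
    ((hasDerivAt_id u).const_sub b).mul_const _
  have h2 : HasDerivAt (fun u => (u - a) * f b) (1 * f b) u :=
    ((hasDerivAt_id u).sub_const a).mul_const _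
  exact ((h1.add h2).div_const (b - a)).congr_deriv (by ring)

lemma linearInterpolant_left (f : ℝ → ℝ) (hab : a < b) : linearInterpolant f a b a = f a := by
  have := (sub_pos.2 hab).ne'
  rw [linearInterpolant]
  field_simp
  ring

lemma linearInterpolant_right (f : ℝ → ℝ) (hab : a < b) : linearInterpolant f a b b = f b := by
  have := (sub_pos.2 hab).ne'
  rw [linearInterpolant]
  field_simp
  ring

lemma abs_sub_linearInterpolant_le (hab : a < b)
    (hd : ∀ u ∈ Set.Icc a b, HasDerivWithinAt f (g u) (Set.Icc a b) u)
    (hg : ∀ u ∈ Set.Icc a b, ∀ v ∈ Set.Icc a b, |g u - g v| ≤ M * |u - v|)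
    {u : ℝ} (hu : u ∈ Set.Icc a b) :
    |f u - linearInterpolant f a b u| ≤ M / 2 * ((u - a) * (b - u)) := by
  have hde (v : ℝ) (hv : v ∈ Set.Icc a b) := (hd v hv).sub
    (hasDerivAt_linearInterpolant f a b v).hasDerivWithinAt
  have hde' (v : ℝ) (hv : v ∈ Set.Icc a b) := (hde v hv).neg
  have hl := linearInterpolant_left f hab
  have hr := linearInterpolant_right f hab
  rw [abs_le']
  constructor
  · exact le_of_hasDerivWithinAt_lipschitz_of_endpoints_eq_zero hab hde
      (fun v hv w hw => by simpa using hg v hv w hw) (by simp [hl]) (by simp [hr]) hu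
  · exact le_of_hasDerivWithinAt_lipschitz_of_endpoints_eq_zero hab hde'
      (fun v hv w hw => by
        have := hg w hw v hv
        rw [abs_sub_comm w v] at this
        convert this using 2
        ring) (by simp [hl]) (by simp [hr]) hu

lemma abs_sub_linearInterpolant_sub_le (hab : a < b)
    (hd : ∀ u ∈ Set.Icc a b, HasDerivWithinAt f (g u) (Set.Icc a b) u)
    (hg : ∀ u ∈ Set.Icc a b, ∀ v ∈ Set.Icc a b, |g u - g v| ≤ M * |u - v|)
    (hM : 0 ≤ M) {u v : ℝ} (hu : u ∈ Set.Icc a b) (hv : v ∈ Set.Icc a b) :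
    |(f u - linearInterpolant f a b u) - (f v - linearInterpolant f a b v)| ≤
      M * (b - a) * |u - v| := by
  obtain ⟨ξ, hξ, hξe⟩ := exists_hasDerivAt_eq_slope f g hab
    (fun w hw => (hd w hw).continuousWithinAt)
    (fun w hw => (hd w (Set.Ioo_subset_Icc_self hw)).hasDerivAt (Icc_mem_nhds hw.1 hw.2))
  refine Convex.norm_image_sub_le_of_norm_hasDerivWithin_le
    (fun w hw => (hd w hw).sub (hasDerivAt_linearInterpolant f a b w).hasDerivWithinAt)
    (fun w hw => ?_) (convex_Icc a b) hv hu
  rw [← hξe, norm_eq_abs]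
  refine (hg w hw ξ (Set.Ioo_subset_Icc_self hξ)).trans ?_
  gcongr
  rw [abs_le]
  constructor <;> linarith [hw.1, hw.2, hξ.1, hξ.2]

end LinearInterpolation

lemma exists_mem_Icc_of_mem_Icc {t : ℕ → ℝ} {n : ℕ} (hn : n ≠ 0) {u : ℝ}
    (hu : u ∈ Set.Icc (t 0) (t n)) : ∃ k < n, u ∈ Set.Icc (t k) (t (k + 1)) := by
  induction n with
  | zero => exact absurd rfl hn
  | succ n ih =>
    rcases le_total (t n) u with h | h
    · exact ⟨n, n.lt_succ_self, h, hu.2⟩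
    · rcases eq_or_ne n 0 with rfl | hn0
      · exact ⟨0, one_pos, hu⟩
      · obtain ⟨k, hk, hku⟩ := ih hn0 ⟨hu.1, h⟩
        exact ⟨k, hk.trans n.lt_succ_self, hku⟩

lemma abs_sub_le_of_piecewise {t : ℕ → ℝ} {e : ℝ → ℝ} {L : ℝ} {n : ℕ}
    (hmono : ∀ k < n, t k ≤ t (k + 1))
    (he : ∀ k < n, ∀ u ∈ Set.Icc (t k) (t (k + 1)), ∀ v ∈ Set.Icc (t k) (t (k + 1)),
      |e u - e v| ≤ L * |u - v|)
    {u v : ℝ} (hu : u ∈ Set.Icc (t 0) (t n)) (hv : v ∈ Set.Icc (t 0) (t n)) :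
    |e u - e v| ≤ L * |u - v| := by
  induction n generalizing u v with
  | zero =>
    rw [Set.Icc_self, Set.mem_singleton_iff] at hu hv
    simp [hu, hv]
  | succ n ih =>
    have ih' {u v : ℝ} := @ih (fun k hk => hmono k (by omega)) (fun k hk => he k (by omega)) u v
    have h0n : t 0 ≤ t n := by
      have : ∀ m ≤ n, t 0 ≤ t m := fun m => by
        induction m with
        | zero => exact fun _ => le_rfl
        | succ m ihm => exact fun hm => (ihm (by omega)).trans (hmono m (by omega))
      exact this n le_rfl
    have hlast := he n n.lt_succ_self
    have hnn := hmono n n.lt_succ_self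
    wlog huv : u ≤ v generalizing u v
    · rw [abs_sub_comm, abs_sub_comm u v]
      exact this hv hu (le_of_not_ge huv)
    rcases le_total v (t n) with hvn | hvn
    · exact ih' ⟨hu.1, huv.trans hvn⟩ ⟨hv.1, hvn⟩
    rcases le_total (t n) u with hun | hun
    · exact hlast u ⟨hun, hu.2⟩ v ⟨hvn, hv.2⟩
    have h1 := ih' (u := u) (v := t n) ⟨hu.1, hun⟩ ⟨h0n, le_rfl⟩
    have h2 := hlast (t n) ⟨le_rfl, hnn⟩ v ⟨hvn, hv.2⟩
    have h3 := abs_sub_le (e u) (e (t n)) (e v)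
    rw [abs_of_nonpos (sub_nonpos.2 hun)] at h1
    rw [abs_of_nonpos (sub_nonpos.2 hvn)] at h2
    rw [abs_of_nonpos (sub_nonpos.2 huv)]
    linarith

lemma one_le_log_of_three_le {N : ℕ} (hN : 3 ≤ N) : 1 ≤ log N := by
  have hN' : (3 : ℝ) ≤ N := by exact_mod_cast hN
  rw [le_log_iff_exp_le (by linarith)]
  linarith [exp_one_lt_d9]

lemma log_quadrature_bound {N : ℕ} (hN : 3 ≤ N) {M h γ : ℝ} (hM : 0 ≤ M) (hh : 0 < h)
    (hhγ : h ≤ γ / N) :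
    2 * (M * h) * (h / 2) + 4 * (M * h ^ 2 / 8) * log (π / (h / 2)) ≤
      M * (γ ^ 2 * log N + π * √2 * γ) / N ^ 2 := by
  have hN0 : (0 : ℝ) < N := by exact_mod_cast (by omega : 0 < N)
  have hlogN := one_le_log_of_three_le hN
  have hs2 : 1 ≤ √2 := one_le_sqrt.2 one_le_two
  have hlog : log (π / (h / 2)) ≤ log N + (2 * π / (h * N) - 1) := by
    have h1 := log_le_sub_one_of_pos (x := 2 * π / (h * N)) (by positivity)
    have h2 : π / (h / 2) = N * (2 * π / (h * N)) := by field_simp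
    rw [h2, log_mul hN0.ne' (by positivity)]
    linarith
  calc 2 * (M * h) * (h / 2) + 4 * (M * h ^ 2 / 8) * log (π / (h / 2))
      ≤ 2 * (M * h) * (h / 2) + 4 * (M * h ^ 2 / 8) * (log N + (2 * π / (h * N) - 1)) := by
        gcongr
    _ = M * (h ^ 2 * ((1 + log N) / 2) + π * 1 * h / N) := by
        field_simp
        ring
    _ ≤ M * ((γ / N) ^ 2 * log N + π * √2 * (γ / N) / N) := by
        gcongr
        linarith
    _ = M * (γ ^ 2 * log N + π * √2 * γ) / N ^ 2 := by
        field_simp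

theorem quadrature_error_CW2_table1
    (N : ℕ) (hN : 3 ≤ N)
    (t : ℕ → ℝ) (ht0 : t 0 = -1) (htN : t N = 1)
    (hmono : ∀ k, k < N → t k < t (k + 1))
    (γ : ℝ) (hγ : 0 < γ)
    (hstep : ∀ k, k < N → t (k + 1) - t k ≤ γ / N)
    (f S : ℝ → ℝ) (M₂ : ℝ)
    (hfc : ContinuousOn f (Set.Icc (-1 : ℝ) 1))
    (hf : ∀ k, k < N → ∃ g : ℝ → ℝ,
      (∀ u ∈ Set.Icc (t k) (t (k + 1)),
        HasDerivWithinAt f (g u) (Set.Icc (t k) (t (k + 1))) u) ∧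
      (∀ u ∈ Set.Icc (t k) (t (k + 1)), ∀ v ∈ Set.Icc (t k) (t (k + 1)),
        |g u - g v| ≤ M₂ * |u - v|))
    (hS : ∀ k, k < N → ∀ u ∈ Set.Icc (t k) (t (k + 1)),
      S u = ((t (k + 1) - u) * f (t k) + (u - t k) * f (t (k + 1))) / (t (k + 1) - t k))
    (x : ℝ) (hx : x ∈ Set.Ioo (-1 : ℝ) 1) :
    ∃ I : ℝ,
      Tendsto (fun ε : ℝ =>
          (∫ u in (-1 : ℝ)..(x - ε), (f u - S u) / (Real.sqrt (1 - u ^ 2) * (u - x))) +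
          ∫ u in (x + ε)..(1 : ℝ), (f u - S u) / (Real.sqrt (1 - u ^ 2) * (u - x)))
        (𝓝[>] (0 : ℝ)) (𝓝 I) ∧
      |Real.sqrt (1 - x ^ 2) / π * I| ≤
        (γ ^ 2 * M₂ / π) * (1 + π * Real.sqrt 2 / (γ * Real.log N)) *
          Real.log N / N ^ 2 := by
  have hN0 : (0 : ℝ) < N := by exact_mod_cast (by omega : 0 < N)
  have hlogN : 0 < log N := one_pos.trans_le (one_le_log_of_three_le hN)
  have hM : 0 ≤ M₂ := by
    obtain ⟨g, -, hg⟩ := hf 0 (by omega)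
    have h01 := hmono 0 (by omega)
    have h := (abs_nonneg _).trans
      (hg _ (Set.left_mem_Icc.2 h01.le) _ (Set.right_mem_Icc.2 h01.le))
    exact nonneg_of_mul_nonneg_left h (abs_pos.2 (sub_neg.2 h01).ne)
  have hle : ∀ m ≤ N, ∀ k ≤ m, t k ≤ t m := fun m => by
    induction m with
    | zero => intro _ k hk; rw [Nat.le_zero.1 hk]
    | succ m ih =>
      intro hm k hk
      rcases Nat.le_succ_iff.1 hk with hk | rfl
      · exact (ih (by omega) k hk).trans (hmono m (by omega)).le
      · exact le_rfl
  set h := min (γ / N) 2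
  have hh : 0 < h := lt_min (by positivity) two_pos
  have hh2 : h ≤ 2 := min_le_right _ _
  have hth (k : ℕ) (hk : k < N) : t (k + 1) - t k ≤ h := by
    refine le_min (hstep k hk) ?_
    linarith [hle N le_rfl (k + 1) hk, hle k hk.le 0 k.zero_le]
  have hSe (k : ℕ) (hk : k < N) (u : ℝ) (hu : u ∈ Set.Icc (t k) (t (k + 1))) :
      S u = linearInterpolant f (t k) (t (k + 1)) u := hS k hk u hu
  have hLip : ∀ u ∈ Set.Icc (-1 : ℝ) 1, ∀ v ∈ Set.Icc (-1 : ℝ) 1,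
      |(f u - S u) - (f v - S v)| ≤ M₂ * h * |u - v| := by
    rw [← ht0, ← htN]
    intro u hu v hv
    refine abs_sub_le_of_piecewise (e := fun u => f u - S u) (fun k hk => (hmono k hk).le)
      (fun k hk u hu v hv => ?_) hu hv
    obtain ⟨g, hd, hg⟩ := hf k hk
    simp only [hSe k hk u hu, hSe k hk v hv]
    refine (abs_sub_linearInterpolant_sub_le (hmono k hk) hd hg hM hu hv).trans ?_
    gcongr
    exact hth k hk
  have hsup : ∀ u ∈ Set.Icc (-1 : ℝ) 1, |f u - S u| ≤ M₂ * h ^ 2 / 8 := by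
    rw [← ht0, ← htN]
    intro u hu
    obtain ⟨k, hk, hku⟩ := exists_mem_Icc_of_mem_Icc (by omega) hu
    obtain ⟨g, hd, hg⟩ := hf k hk
    rw [hSe k hk u hku]
    refine (abs_sub_linearInterpolant_le (hmono k hk) hd hg hku).trans ?_
    have hsq : (u - t k) * (t (k + 1) - u) ≤ h ^ 2 / 4 := by
      have := hth k hk
      have := hmono k hk
      nlinarith [sq_nonneg ((u - t k) - (t (k + 1) - u))]
    calc M₂ / 2 * ((u - t k) * (t (k + 1) - u)) ≤ M₂ / 2 * (h ^ 2 / 4) := by gcongr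
      _ = M₂ * h ^ 2 / 8 := by ring
  refine ⟨_, tendsto_chebyshev_principalValue (e := fun u => f u - S u) hx
    (mul_nonneg hM hh.le) hLip, ?_⟩
  have hbound := (abs_integral_chebyshevQuotient_le (e := fun u => f u - S u) hx
    (mul_nonneg hM hh.le) hLip hsup (half_pos hh) (by linarith [pi_gt_three])).trans
    (log_quadrature_bound hN hM hh (min_le_left _ _))
  rw [abs_mul, abs_of_nonneg (by positivity), div_mul_eq_mul_div]
  calc _ ≤ M₂ * (γ ^ 2 * log N + π * √2 * γ) / N ^ 2 / π := by gcongr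
    _ = _ := by field_simp
end

section
/- Let f belong to W¹[−1,1] with constant M₁. Then for every x ∈ (−1,1) the Cauchy principal value R_N(f,x) = J(f − S_N, x) exists and satisfies |R_N(f,x)| ≤ (2γM₁/π)·(1 + 12π/(γ·ln N))·(ln N)/N. -/
open Real MeasureTheory Filter Topology

theorem exists_mem_Icc_of_grid {t : ℕ → ℝ} {n : ℕ} {u : ℝ} (hn : 0 < n)
    (hu : u ∈ Set.Icc (t 0) (t n)) : ∃ k < n, u ∈ Set.Icc (t k) (t (k + 1)) := by
  induction n with
  | zero => omega
  | succ n ih =>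
    rcases Nat.eq_zero_or_pos n with rfl | hn'
    · exact ⟨0, by omega, hu⟩
    · rcases le_total u (t n) with h | h
      · obtain ⟨k, hk, hk'⟩ := ih hn' ⟨hu.1, h⟩
        exact ⟨k, by omega, hk'⟩
      · exact ⟨n, by omega, h, hu.2⟩

theorem abs_sub_le_of_grid {t : ℕ → ℝ} {S : ℝ → ℝ} {M : ℝ} {n : ℕ}
    (hmono : ∀ k < n, t k < t (k + 1))
    (h : ∀ k < n, ∀ u ∈ Set.Icc (t k) (t (k + 1)), ∀ v ∈ Set.Icc (t k) (t (k + 1)),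
      u ≤ v → |S u - S v| ≤ M * (v - u)) :
    ∀ u ∈ Set.Icc (t 0) (t n), ∀ v ∈ Set.Icc (t 0) (t n), u ≤ v →
      |S u - S v| ≤ M * (v - u) := by
  induction n with
  | zero =>
    intro u hu v hv _
    have : u = v := by linarith [hu.1, hu.2, hv.1, hv.2]
    simp [this]
  | succ n ih =>
    intro u hu v hv huv
    have ih' := ih (fun k hk => hmono k (by omega)) (fun k hk => h k (by omega))
    have hn := hmono n (by omega)
    rcases le_total v (t n) with hvn | hvn
    · exact ih' u ⟨hu.1, huv.trans hvn⟩ v ⟨hv.1, hvn⟩ huv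
    rcases le_total u (t n) with hun | hun
    · have h1 := ih' u ⟨hu.1, hun⟩ (t n) ⟨hu.1.trans hun, le_rfl⟩ hun
      have h2 := h n (by omega) (t n) ⟨le_rfl, hn.le⟩ v ⟨hvn, hv.2⟩ hvn
      have h3 := abs_sub_le (S u) (S (t n)) (S v)
      linarith
    · exact h n (by omega) u ⟨hun, hu.2⟩ v ⟨hvn, hv.2⟩ huv

theorem abs_linearInterp_sub_le {f S : ℝ → ℝ} {a b M : ℝ} (hab : a < b)
    (hf : |f a - f b| ≤ M * |a - b|)
    (hS : ∀ u ∈ Set.Icc a b, S u = ((b - u) * f a + (u - a) * f b) / (b - a)) :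
    ∀ u ∈ Set.Icc a b, ∀ v ∈ Set.Icc a b, u ≤ v → |S u - S v| ≤ M * (v - u) := by
  intro u hu v hv huv
  have hd : 0 < b - a := sub_pos.2 hab
  rw [abs_sub_comm a b, abs_of_pos hd] at hf
  have : S u - S v = (f a - f b) / (b - a) * (v - u) := by
    rw [hS u hu, hS v hv]; field_simp; ring
  rw [this, abs_mul, abs_of_nonneg (sub_nonneg.2 huv), abs_div, abs_of_pos hd]
  exact mul_le_mul_of_nonneg_right ((div_le_iff₀ hd).2 hf) (sub_nonneg.2 huv)

theorem abs_sub_linearInterp_le {f : ℝ → ℝ} {a b u M : ℝ} (hab : a < b) (hM : 0 ≤ M)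
    (hu : u ∈ Set.Icc a b) (hfa : |f u - f a| ≤ M * |u - a|) (hfb : |f u - f b| ≤ M * |u - b|) :
    |f u - ((b - u) * f a + (u - a) * f b) / (b - a)| ≤ M * (b - a) / 2 := by
  have hd : 0 < b - a := sub_pos.2 hab
  have h1 : 0 ≤ u - a := sub_nonneg.2 hu.1
  have h2 : 0 ≤ b - u := sub_nonneg.2 hu.2
  rw [abs_of_nonneg h1] at hfa
  rw [abs_sub_comm u b, abs_of_nonneg h2] at hfb
  have : f u - ((b - u) * f a + (u - a) * f b) / (b - a)
      = ((b - u) * (f u - f a) + (u - a) * (f u - f b)) / (b - a) := by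
    field_simp; ring
  rw [this, abs_div, abs_of_pos hd, div_le_iff₀ hd]
  have h3 := abs_add_le ((b - u) * (f u - f a)) ((u - a) * (f u - f b))
  rw [abs_mul, abs_mul, abs_of_nonneg h1, abs_of_nonneg h2] at h3
  have h4 := mul_le_mul_of_nonneg_left hfa h2
  have h5 := mul_le_mul_of_nonneg_left hfb h1
  nlinarith [mul_nonneg hM (sq_nonneg ((b - u) - (u - a)))]

theorem cos_add_cos_mul_sub_le {p q : ℝ} (hp : -(π / 2) ≤ p) (hq : q ≤ π / 2) (hpq : p ≤ q) :
    (cos p + cos q) * (q - p) ≤ π * (sin q - sin p) := by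
  have h1 : 0 ≤ cos ((p + q) / 2) := cos_nonneg_of_mem_Icc ⟨by linarith, by linarith⟩
  have h2 : 2 / π * ((q - p) / 2) ≤ sin ((q - p) / 2) := mul_le_sin (by linarith) (by linarith)
  have h3 : q - p ≤ π * sin ((q - p) / 2) := by
    have := mul_le_mul_of_nonneg_left h2 pi_pos.le
    have e : π * (2 / π * ((q - p) / 2)) = q - p := by field_simp
    linarith
  have h4 : cos p + cos q ≤ 2 * cos ((p + q) / 2) := by
    rw [cos_add_cos]
    nlinarith [cos_le_one ((p - q) / 2)]
  rw [sin_sub_sin, add_comm q p]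
  calc _ ≤ 2 * cos ((p + q) / 2) * (π * sin ((q - p) / 2)) :=
        mul_le_mul h4 h3 (by linarith) (by linarith)
    _ = _ := by ring

theorem sqrt_add_sqrt_mul_arcsin_sub_le {a b : ℝ} (ha : -1 ≤ a) (hab : a ≤ b) (hb : b ≤ 1) :
    (√(1 - a ^ 2) + √(1 - b ^ 2)) * (arcsin b - arcsin a) ≤ π * (b - a) := by
  have := cos_add_cos_mul_sub_le (neg_pi_div_two_le_arcsin a) (arcsin_le_pi_div_two b)
    (monotone_arcsin hab)
  rwa [cos_arcsin, cos_arcsin, sin_arcsin ha (hab.trans hb), sin_arcsin (ha.trans hab) hb] at this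

theorem hasDerivAt_arcsin_Ioo {u : ℝ} (hu : u ∈ Set.Ioo (-1 : ℝ) 1) :
    HasDerivAt arcsin (1 / √(1 - u ^ 2)) u :=
  hasDerivAt_arcsin hu.1.ne' hu.2.ne

theorem intervalIntegrable_one_div_sqrt {a b : ℝ} (ha : -1 ≤ a) (hab : a ≤ b) (hb : b ≤ 1) :
    IntervalIntegrable (fun u : ℝ => 1 / √(1 - u ^ 2)) volume a b := by
  apply intervalIntegral.intervalIntegrable_deriv_of_nonneg (g := arcsin)
    continuous_arcsin.continuousOn
  · intro u hu
    rw [min_eq_left hab, max_eq_right hab] at hu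
    exact hasDerivAt_arcsin_Ioo ⟨ha.trans_lt hu.1, hu.2.trans_le hb⟩
  · intro u _; positivity

theorem integral_one_div_sqrt {a b : ℝ} (ha : -1 ≤ a) (hab : a ≤ b) (hb : b ≤ 1) :
    ∫ u in a..b, 1 / √(1 - u ^ 2) = arcsin b - arcsin a :=
  intervalIntegral.integral_eq_sub_of_hasDerivAt_of_le hab continuous_arcsin.continuousOn
    (fun _ hu => hasDerivAt_arcsin_Ioo ⟨ha.trans_lt hu.1, hu.2.trans_le hb⟩)
    (intervalIntegrable_one_div_sqrt ha hab hb)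

/-- A primitive on `[-1, 1] \ {x}` of the airfoil kernel `√(1 - x²) / (√(1 - u²) (u - x))`. -/
noncomputable def airfoilPrimitive (x u : ℝ) : ℝ :=
  log (u - x) - log (1 - x * u + √(1 - x ^ 2) * √(1 - u ^ 2))

theorem airfoil_denom_pos {x u : ℝ} (hx : x ∈ Set.Ioo (-1 : ℝ) 1) (hu : u ∈ Set.Icc (-1 : ℝ) 1) :
    0 < 1 - x * u + √(1 - x ^ 2) * √(1 - u ^ 2) := by
  have : 0 ≤ √(1 - x ^ 2) * √(1 - u ^ 2) := by positivity
  nlinarith [hx.1, hx.2, hu.1, hu.2, mul_nonneg (sub_nonneg.2 hx.2.le) (sub_nonneg.2 hu.1),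
    mul_nonneg (sub_nonneg.2 hx.1.le) (sub_nonneg.2 hu.2)]

theorem airfoil_denom_le_two {x u : ℝ} (hx : x ∈ Set.Ioo (-1 : ℝ) 1)
    (hu : u ∈ Set.Icc (-1 : ℝ) 1) :
    1 - x * u + √(1 - x ^ 2) * √(1 - u ^ 2) ≤ 2 := by
  have h1 : √(1 - x ^ 2) ^ 2 = 1 - x ^ 2 := sq_sqrt (by nlinarith [hx.1, hx.2])
  have h2 : √(1 - u ^ 2) ^ 2 = 1 - u ^ 2 := sq_sqrt (by nlinarith [hu.1, hu.2])
  nlinarith [sq_nonneg (√(1 - x ^ 2) - √(1 - u ^ 2)), sq_nonneg (x + u)]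

theorem airfoilPrimitive_one (x : ℝ) : airfoilPrimitive x 1 = 0 := by
  simp [airfoilPrimitive]

theorem airfoilPrimitive_neg_one (x : ℝ) : airfoilPrimitive x (-1) = 0 := by
  have : log (-1 - x) = log (1 + x) := by
    rw [show -1 - x = -(1 + x) by ring, log_neg_eq_log]
  simp [airfoilPrimitive, this]

theorem continuousOn_airfoilPrimitive {x : ℝ} (hx : x ∈ Set.Ioo (-1 : ℝ) 1) :
    ContinuousOn (airfoilPrimitive x) (Set.Icc (-1) 1 \ {x}) := by
  unfold airfoilPrimitive
  refine ContinuousOn.sub (ContinuousOn.log (by fun_prop) ?_) (ContinuousOn.log (by fun_prop) ?_)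
  · intro u hu; exact sub_ne_zero.2 hu.2
  · intro u hu; exact (airfoil_denom_pos hx hu.1).ne'

theorem hasDerivAt_airfoilPrimitive {x u : ℝ} (hx : x ∈ Set.Ioo (-1 : ℝ) 1)
    (hu : u ∈ Set.Ioo (-1 : ℝ) 1) (hux : u ≠ x) :
    HasDerivAt (airfoilPrimitive x) (√(1 - x ^ 2) / (√(1 - u ^ 2) * (u - x))) u := by
  have hw : 0 < 1 - u ^ 2 := by nlinarith [hu.1, hu.2]
  have hs : 0 < 1 - x ^ 2 := by nlinarith [hx.1, hx.2]
  have hd := airfoil_denom_pos hx ⟨hu.1.le, hu.2.le⟩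
  have hux' := sub_ne_zero.2 hux
  have h1 : HasDerivAt (fun u : ℝ => 1 - u ^ 2) (-(2 * u)) u := by
    simpa using ((hasDerivAt_id u).pow 2).const_sub 1
  have h2 := ((((hasDerivAt_id u).const_mul x).const_sub 1).add
    ((h1.sqrt hw.ne').const_mul √(1 - x ^ 2))).log hd.ne'
  have h3 := (((hasDerivAt_id u).sub_const x).log hux').sub h2
  refine h3.congr_deriv ?_
  have e1 := sq_sqrt hw.le
  have e2 := sq_sqrt hs.le
  have p1 := sqrt_pos.2 hw
  have p2 := sqrt_pos.2 hs
  simp only [id, Pi.add_apply, mul_one]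
  generalize √(1 - u ^ 2) = w at *
  generalize √(1 - x ^ 2) = s at *
  generalize hD : 1 - x * u + s * w = D at *
  have hd' := hd.ne'
  have hw' := p1.ne'
  field_simp
  linear_combination (s - w) * hD + s * e1 - w * e2

theorem neg_airfoilPrimitive_le {x u δ : ℝ} (hx : x ∈ Set.Ioo (-1 : ℝ) 1)
    (hu : u ∈ Set.Icc (-1 : ℝ) 1) (hδ : 0 < δ) (h : δ ≤ |u - x|) :
    -airfoilPrimitive x u ≤ log (2 / δ) := by
  have h1 : log (1 - x * u + √(1 - x ^ 2) * √(1 - u ^ 2)) ≤ log 2 :=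
    log_le_log (airfoil_denom_pos hx hu) (airfoil_denom_le_two hx hu)
  have h2 : log δ ≤ log (u - x) := by
    rw [← log_abs (u - x)]; exact log_le_log hδ h
  rw [log_div two_ne_zero hδ.ne', airfoilPrimitive]
  linarith

theorem tendsto_airfoilPrimitive_sub {x : ℝ} (hx : x ∈ Set.Ioo (-1 : ℝ) 1) :
    Tendsto (fun ε => airfoilPrimitive x (x - ε) - airfoilPrimitive x (x + ε))
      (𝓝[>] 0) (𝓝 0) := by
  have hD : ContinuousAt
      (fun u => log (1 - x * u + √(1 - x ^ 2) * √(1 - u ^ 2))) x :=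
    ContinuousAt.log (by fun_prop) (airfoil_denom_pos hx ⟨hx.1.le, hx.2.le⟩).ne'
  have hp : Tendsto (fun ε : ℝ => x + ε) (𝓝[>] 0) (𝓝 x) := by
    have : Tendsto (fun ε : ℝ => x + ε) (𝓝 0) (𝓝 (x + 0)) := by
      apply Continuous.tendsto; fun_prop
    rw [add_zero] at this
    exact this.mono_left nhdsWithin_le_nhds
  have hm : Tendsto (fun ε : ℝ => x - ε) (𝓝[>] 0) (𝓝 x) := by
    have : Tendsto (fun ε : ℝ => x - ε) (𝓝 0) (𝓝 (x - 0)) := by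
      apply Continuous.tendsto; fun_prop
    rw [sub_zero] at this
    exact this.mono_left nhdsWithin_le_nhds
  have h := (hD.tendsto.comp hp).sub (hD.tendsto.comp hm)
  rw [sub_self] at h
  refine h.congr fun ε => ?_
  simp only [airfoilPrimitive, Function.comp, sub_sub_cancel_left, add_sub_cancel_left,
    log_neg_eq_log]
  ring

theorem intervalIntegrable_and_integral_airfoil_kernel {x a b : ℝ} (hx : x ∈ Set.Ioo (-1 : ℝ) 1)
    (ha : -1 ≤ a) (hab : a ≤ b) (hb : b ≤ 1) (h : b < x ∨ x < a) :
    IntervalIntegrable (fun u => √(1 - x ^ 2) / (√(1 - u ^ 2) * (u - x))) volume a b ∧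
      ∫ u in a..b, √(1 - x ^ 2) / (√(1 - u ^ 2) * (u - x))
        = airfoilPrimitive x b - airfoilPrimitive x a := by
  have hcont : ContinuousOn (airfoilPrimitive x) (Set.Icc a b) := by
    refine (continuousOn_airfoilPrimitive hx).mono fun u hu =>
      ⟨⟨ha.trans hu.1, hu.2.trans hb⟩, ?_⟩
    rintro rfl
    rcases h with h | h <;> linarith [hu.1, hu.2]
  have hderiv : ∀ u ∈ Set.Ioo a b, HasDerivAt (airfoilPrimitive x)
      (√(1 - x ^ 2) / (√(1 - u ^ 2) * (u - x))) u := fun u hu =>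
    hasDerivAt_airfoilPrimitive hx ⟨ha.trans_lt hu.1, hu.2.trans_le hb⟩ (by
      rintro rfl
      rcases h with h | h <;> linarith [hu.1, hu.2])
  have hint : IntervalIntegrable (fun u => √(1 - x ^ 2) / (√(1 - u ^ 2) * (u - x)))
      volume a b := by
    rcases h with h | h
    · have := intervalIntegral.intervalIntegrable_deriv_of_nonneg (a := a) (b := b)
        (g := fun u => -airfoilPrimitive x u)
        (g' := fun u => -(√(1 - x ^ 2) / (√(1 - u ^ 2) * (u - x))))
        (by rw [Set.uIcc_of_le hab]; exact hcont.neg)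
        (by rw [min_eq_left hab, max_eq_right hab]; exact fun u hu => (hderiv u hu).neg)
        (by
          rw [min_eq_left hab, max_eq_right hab]
          intro u hu
          rw [neg_nonneg]
          exact div_nonpos_of_nonneg_of_nonpos (by positivity)
            (mul_nonpos_of_nonneg_of_nonpos (by positivity) (by linarith [hu.2])))
      simpa only [Pi.neg_def, neg_neg] using this.neg
    · exact intervalIntegral.intervalIntegrable_deriv_of_nonneg
        (by rwa [Set.uIcc_of_le hab])
        (by rwa [min_eq_left hab, max_eq_right hab])
        (by
          rw [min_eq_left hab, max_eq_right hab]
          intro u hu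
          exact div_nonneg (by positivity) (mul_nonneg (by positivity) (by linarith [hu.1])))
  exact ⟨hint, intervalIntegral.integral_eq_sub_of_hasDerivAt_of_le hab hcont hderiv hint⟩

theorem intervalIntegrable_airfoil_quotient {g : ℝ → ℝ} {x L : ℝ}
    (hg : ContinuousOn g (Set.Icc (-1) 1))
    (hL : ∀ u ∈ Set.Icc (-1 : ℝ) 1, |g u - g x| ≤ L * |u - x|) :
    IntervalIntegrable (fun u => (g u - g x) / (√(1 - u ^ 2) * (u - x))) volume (-1) 1 := by
  have h0 := (intervalIntegrable_one_div_sqrt le_rfl (by norm_num : (-1 : ℝ) ≤ 1) le_rfl).const_mul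
    |L|
  rw [intervalIntegrable_iff_integrableOn_Icc_of_le (by norm_num)] at h0 ⊢
  refine Integrable.mono' h0 ?_ ?_
  · simp only [div_eq_mul_inv]
    refine AEStronglyMeasurable.mul ?_ (Measurable.aestronglyMeasurable (by fun_prop))
    exact (hg.sub continuousOn_const).aestronglyMeasurable measurableSet_Icc
  · refine (ae_restrict_iff' measurableSet_Icc).2 (Eventually.of_forall fun u hu => ?_)
    rw [norm_eq_abs, abs_div, abs_mul, abs_of_nonneg (sqrt_nonneg _), mul_one_div]
    rcases eq_or_ne u x with rfl | hux
    · simp; positivity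
    · have : 0 < |u - x| := abs_pos.2 (sub_ne_zero.2 hux)
      rw [mul_comm √_, ← div_div]
      gcongr
      rw [div_le_iff₀ this]
      exact (hL u hu).trans (by gcongr; exact le_abs_self L)

theorem tendsto_airfoil_integral {g : ℝ → ℝ} {x L : ℝ} (hx : x ∈ Set.Ioo (-1 : ℝ) 1)
    (hg : ContinuousOn g (Set.Icc (-1) 1))
    (hL : ∀ u ∈ Set.Icc (-1 : ℝ) 1, |g u - g x| ≤ L * |u - x|) :
    Tendsto (fun ε : ℝ =>
        (∫ u in (-1 : ℝ)..(x - ε), g u / (√(1 - u ^ 2) * (u - x))) +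
        ∫ u in (x + ε)..(1 : ℝ), g u / (√(1 - u ^ 2) * (u - x)))
      (𝓝[>] (0 : ℝ))
      (𝓝 (∫ u in (-1 : ℝ)..1, (g u - g x) / (√(1 - u ^ 2) * (u - x)))) := by
  have hI := intervalIntegrable_airfoil_quotient hg hL
  set h : ℝ → ℝ := fun u => (g u - g x) / (√(1 - u ^ 2) * (u - x)) with hh
  have hs : √(1 - x ^ 2) ≠ 0 := (sqrt_pos.2 (by nlinarith [hx.1, hx.2])).ne'
  have hsplit : ∀ u, g u / (√(1 - u ^ 2) * (u - x))
      = h u + g x / √(1 - x ^ 2) * (√(1 - x ^ 2) / (√(1 - u ^ 2) * (u - x))) := fun u => by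
    rw [div_mul_div_cancel₀ hs, hh, ← add_div, sub_add_cancel]
  have hsub : ∀ {a b : ℝ}, -1 ≤ a → a ≤ b → b ≤ 1 → IntervalIntegrable h volume a b :=
    fun ha hab hb => hI.mono_set (by
      rw [Set.uIcc_of_le hab, Set.uIcc_of_le (by norm_num)]; exact Set.Icc_subset_Icc ha hb)
  have hpiece : ∀ {a b : ℝ}, -1 ≤ a → a ≤ b → b ≤ 1 → (b < x ∨ x < a) →
      ∫ u in a..b, g u / (√(1 - u ^ 2) * (u - x)) = (∫ u in a..b, h u) +
        g x / √(1 - x ^ 2) * (airfoilPrimitive x b - airfoilPrimitive x a) := by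
    intro a b ha hab hb hc
    obtain ⟨k1, k2⟩ := intervalIntegrable_and_integral_airfoil_kernel hx ha hab hb hc
    simp only [hsplit]
    rw [intervalIntegral.integral_add (hsub ha hab hb) (k1.const_mul _),
      intervalIntegral.integral_const_mul, k2]
  have hP : ContinuousOn (fun b => ∫ u in x..b, h u) (Set.Icc (-1) 1) := by
    have := intervalIntegral.continuousOn_primitive_interval' (a := x) hI
      (by rw [Set.uIcc_of_le (by norm_num)]; exact ⟨hx.1.le, hx.2.le⟩)
    rwa [Set.uIcc_of_le (by norm_num)] at this
  have hPx : ContinuousAt (fun b => ∫ u in x..b, h u) x :=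
    hP.continuousAt (Icc_mem_nhds hx.1 hx.2)
  have hp : Tendsto (fun ε : ℝ => x + ε) (𝓝[>] 0) (𝓝 x) := by
    have : Tendsto (fun ε : ℝ => x + ε) (𝓝 0) (𝓝 (x + 0)) := by
      apply Continuous.tendsto; fun_prop
    rw [add_zero] at this
    exact this.mono_left nhdsWithin_le_nhds
  have hm : Tendsto (fun ε : ℝ => x - ε) (𝓝[>] 0) (𝓝 x) := by
    have : Tendsto (fun ε : ℝ => x - ε) (𝓝 0) (𝓝 (x - 0)) := by
      apply Continuous.tendsto; fun_prop
    rw [sub_zero] at this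
    exact this.mono_left nhdsWithin_le_nhds
  have hlim := (((hPx.tendsto.comp hm).sub (hPx.tendsto.comp hp)).add
    ((tendsto_airfoilPrimitive_sub hx).const_mul (g x / √(1 - x ^ 2)))).const_add
    (∫ u in (-1 : ℝ)..1, h u)
  rw [sub_self, mul_zero, add_zero, add_zero] at hlim
  refine hlim.congr' ?_
  have hsmall : ∀ᶠ ε : ℝ in 𝓝[>] 0, ε < min (x + 1) (1 - x) :=
    nhdsWithin_le_nhds (eventually_lt_nhds (lt_min (by linarith [hx.1]) (by linarith [hx.2])))
  filter_upwards [hsmall, self_mem_nhdsWithin] with ε h1 h0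
  have h0' : 0 < ε := h0
  have h2 : ε < x + 1 := h1.trans_le (min_le_left _ _)
  have h3 : ε < 1 - x := h1.trans_le (min_le_right _ _)
  rw [hpiece (a := -1) (b := x - ε) le_rfl (by linarith) (by linarith) (Or.inl (by linarith)),
    hpiece (a := x + ε) (b := 1) (by linarith) (by linarith) le_rfl (Or.inr (by linarith)),
    airfoilPrimitive_one, airfoilPrimitive_neg_one]
  have i1 := hsub (a := -1) (b := x - ε) le_rfl (by linarith) (by linarith)
  have i2 := hsub (a := x - ε) (b := x) (by linarith) (by linarith) hx.2.le
  have i3 := hsub (a := x) (b := x + ε) hx.1.le (by linarith) (by linarith)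
  have i4 := hsub (a := x + ε) (b := 1) (by linarith) (by linarith) le_rfl
  have e1 := intervalIntegral.integral_add_adjacent_intervals i1 i2
  have e2 := intervalIntegral.integral_add_adjacent_intervals i3 i4
  have e3 := intervalIntegral.integral_add_adjacent_intervals (i1.trans i2) (i3.trans i4)
  have e4 := intervalIntegral.integral_symm (μ := volume) (f := h) x (x - ε)
  simp only [Function.comp]
  linear_combination e4 - e1 - e2 - e3

theorem abs_mul_integral_airfoil_quotient_le {g : ℝ → ℝ} {x L C δ : ℝ}
    (hx : x ∈ Set.Ioo (-1 : ℝ) 1) (hg : ContinuousOn g (Set.Icc (-1) 1))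
    (hL0 : 0 ≤ L) (hL : ∀ u ∈ Set.Icc (-1 : ℝ) 1, |g u - g x| ≤ L * |u - x|)
    (hC : ∀ u ∈ Set.Icc (-1 : ℝ) 1, |g u - g x| ≤ C) (hδ : 0 < δ) (hδ2 : δ ≤ 2) :
    |√(1 - x ^ 2) * ∫ u in (-1 : ℝ)..1, (g u - g x) / (√(1 - u ^ 2) * (u - x))|
      ≤ 2 * C * log (2 / δ) + 2 * π * L * δ := by
  have hI := intervalIntegrable_airfoil_quotient hg hL
  have hC0 : 0 ≤ C := (abs_nonneg _).trans (hC x ⟨hx.1.le, hx.2.le⟩)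
  have hs : 0 ≤ √(1 - x ^ 2) := sqrt_nonneg _
  have hlog : 0 ≤ log (2 / δ) := log_nonneg (by rwa [one_le_div hδ])
  obtain ⟨a, ha1, hax, had, hLa⟩ : ∃ a, -1 ≤ a ∧ a < x ∧ x - a ≤ δ ∧
      -airfoilPrimitive x a ≤ log (2 / δ) := by
    rcases le_total (x - δ) (-1) with h | h
    · exact ⟨-1, le_rfl, hx.1, by linarith, by rwa [airfoilPrimitive_neg_one, neg_zero]⟩
    · refine ⟨x - δ, h, by linarith, by linarith,
        neg_airfoilPrimitive_le hx ⟨h, by linarith [hx.2]⟩ hδ ?_⟩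
      rw [sub_sub_cancel_left, abs_neg]; exact le_abs_self δ
  obtain ⟨b, hb1, hxb, hbd, hLb⟩ : ∃ b, b ≤ 1 ∧ x < b ∧ b - x ≤ δ ∧
      -airfoilPrimitive x b ≤ log (2 / δ) := by
    rcases le_total 1 (x + δ) with h | h
    · exact ⟨1, le_rfl, hx.2, by linarith, by rwa [airfoilPrimitive_one, neg_zero]⟩
    · refine ⟨x + δ, h, by linarith, by linarith,
        neg_airfoilPrimitive_le hx ⟨by linarith [hx.1], h⟩ hδ ?_⟩
      rw [add_sub_cancel_left]; exact le_abs_self δ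
  rw [← intervalIntegral.integral_const_mul]
  have hI' := hI.const_mul √(1 - x ^ 2)
  set F : ℝ → ℝ := fun u => √(1 - x ^ 2) * ((g u - g x) / (√(1 - u ^ 2) * (u - x))) with hF
  have hFabs : ∀ u, |F u| = √(1 - x ^ 2) * (|g u - g x| / (√(1 - u ^ 2) * |u - x|)) := fun u => by
    rw [hF, abs_mul, abs_div, abs_mul, abs_of_nonneg hs, abs_of_nonneg (sqrt_nonneg _)]
  have hsub : ∀ {p q : ℝ}, -1 ≤ p → p ≤ q → q ≤ 1 → IntervalIntegrable F volume p q :=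
    fun hp hpq hq => hI'.mono_set (by
      rw [Set.uIcc_of_le hpq, Set.uIcc_of_le (by norm_num)]; exact Set.Icc_subset_Icc hp hq)
  have hfar : ∀ u ∈ Set.Icc (-1 : ℝ) 1,
      |F u| ≤ C * (√(1 - x ^ 2) / (√(1 - u ^ 2) * |u - x|)) := fun u hu => by
    rw [hFabs, mul_div_left_comm]
    exact mul_le_mul_of_nonneg_right (hC u hu) (by positivity)
  have hnear : ∀ u ∈ Set.Icc (-1 : ℝ) 1,
      |F u| ≤ L * √(1 - x ^ 2) * (1 / √(1 - u ^ 2)) := fun u hu => by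
    rw [hFabs]
    rcases eq_or_ne u x with rfl | hux
    · simp; positivity
    · have : 0 < |u - x| := abs_pos.2 (sub_ne_zero.2 hux)
      rw [mul_comm √(1 - u ^ 2), ← div_div, mul_comm L, mul_assoc, mul_one_div]
      gcongr
      rw [div_le_iff₀ this]
      exact hL u hu
  clear_value F
  have hfarLeft : |∫ u in (-1 : ℝ)..a, F u| ≤ C * log (2 / δ) := by
    obtain ⟨k1, k2⟩ := intervalIntegrable_and_integral_airfoil_kernel hx le_rfl ha1
      (by linarith [hx.2]) (Or.inl hax)
    have := intervalIntegral.norm_integral_le_of_norm_le (f := F) ha1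
      (Eventually.of_forall fun u hu => ?_) (k1.const_mul (-C))
    · rw [intervalIntegral.integral_const_mul, k2, airfoilPrimitive_neg_one] at this
      refine this.trans ?_
      nlinarith
    · refine (hfar u ⟨hu.1.le, by linarith [hu.2, hx.2]⟩).trans_eq ?_
      rw [abs_of_neg (by linarith [hu.2]), mul_neg, div_neg]
      ring
  have hfarRight : |∫ u in b..1, F u| ≤ C * log (2 / δ) := by
    obtain ⟨k1, k2⟩ := intervalIntegrable_and_integral_airfoil_kernel hx
      (by linarith [hx.1]) hb1 le_rfl (Or.inr hxb)
    have := intervalIntegral.norm_integral_le_of_norm_le (f := F) hb1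
      (Eventually.of_forall fun u hu => ?_) (k1.const_mul C)
    · rw [intervalIntegral.integral_const_mul, k2, airfoilPrimitive_one] at this
      refine this.trans ?_
      nlinarith
    · refine (hfar u ⟨by linarith [hu.1, hx.1], hu.2⟩).trans_eq ?_
      rw [abs_of_pos (by linarith [hu.1])]
  have hnearInt : ∀ {p q : ℝ}, -1 ≤ p → p ≤ q → q ≤ 1 → (x = p ∨ x = q) → q - p ≤ δ →
      |∫ u in p..q, F u| ≤ π * L * δ := by
    intro p q hp hpq hq hxpq hd
    have := intervalIntegral.norm_integral_le_of_norm_le (f := F) hpq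
      (Eventually.of_forall fun u hu => hnear u ⟨hp.trans hu.1.le, hu.2.trans hq⟩)
      ((intervalIntegrable_one_div_sqrt hp hpq hq).const_mul (L * √(1 - x ^ 2)))
    rw [intervalIntegral.integral_const_mul, integral_one_div_sqrt hp hpq hq] at this
    refine this.trans ?_
    have hA : 0 ≤ arcsin q - arcsin p := sub_nonneg.2 (monotone_arcsin hpq)
    have hB := sqrt_add_sqrt_mul_arcsin_sub_le hp hpq hq
    have hle : √(1 - x ^ 2) ≤ √(1 - p ^ 2) + √(1 - q ^ 2) := by
      rcases hxpq with rfl | rfl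
      · linarith [sqrt_nonneg (1 - q ^ 2)]
      · linarith [sqrt_nonneg (1 - p ^ 2)]
    calc L * √(1 - x ^ 2) * (arcsin q - arcsin p)
        = L * (√(1 - x ^ 2) * (arcsin q - arcsin p)) := by ring
      _ ≤ L * (π * δ) := by
        exact mul_le_mul_of_nonneg_left
          ((mul_le_mul_of_nonneg_right hle hA).trans (hB.trans (by gcongr))) hL0
      _ = π * L * δ := by ring
  have hnearLeft := hnearInt ha1 hax.le hx.2.le (Or.inr rfl) had
  have hnearRight := hnearInt hx.1.le hxb.le hb1 (Or.inl rfl) hbd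
  have i1 := hsub le_rfl ha1 (by linarith [hx.2])
  have i2 := hsub ha1 hax.le hx.2.le
  have i3 := hsub hx.1.le hxb.le hb1
  have i4 := hsub (by linarith [hx.1]) hb1 le_rfl
  rw [← intervalIntegral.integral_add_adjacent_intervals (i1.trans i2) (i3.trans i4),
    ← intervalIntegral.integral_add_adjacent_intervals i1 i2,
    ← intervalIntegral.integral_add_adjacent_intervals i3 i4]
  refine (abs_add_le _ _).trans ?_
  linarith [abs_add_le (∫ u in (-1 : ℝ)..a, F u) (∫ u in a..x, F u),
    abs_add_le (∫ u in x..b, F u) (∫ u in b..1, F u)]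

theorem quadrature_error_W1_table3
    (N : ℕ) (hN : 3 ≤ N)
    (t : ℕ → ℝ) (ht0 : t 0 = -1) (htN : t N = 1)
    (hmono : ∀ k, k < N → t k < t (k + 1))
    (γ : ℝ) (hγ : 0 < γ)
    (hstep : ∀ k, k < N → t (k + 1) - t k ≤ γ / N)
    (f S : ℝ → ℝ) (M₁ : ℝ)
    (hf : ∀ u ∈ Set.Icc (-1 : ℝ) 1, ∀ v ∈ Set.Icc (-1 : ℝ) 1,
      |f u - f v| ≤ M₁ * |u - v|)
    (hS : ∀ k, k < N → ∀ u ∈ Set.Icc (t k) (t (k + 1)),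
      S u = ((t (k + 1) - u) * f (t k) + (u - t k) * f (t (k + 1))) / (t (k + 1) - t k))
    (x : ℝ) (hx : x ∈ Set.Ioo (-1 : ℝ) 1) :
    ∃ I : ℝ,
      Tendsto (fun ε : ℝ =>
          (∫ u in (-1 : ℝ)..(x - ε), (f u - S u) / (Real.sqrt (1 - u ^ 2) * (u - x))) +
          ∫ u in (x + ε)..(1 : ℝ), (f u - S u) / (Real.sqrt (1 - u ^ 2) * (u - x)))
        (𝓝[>] (0 : ℝ)) (𝓝 I) ∧
      |Real.sqrt (1 - x ^ 2) / π * I| ≤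
        (2 * γ * M₁ / π) * (1 + 12 * π / (γ * Real.log N)) *
          Real.log N / N := by
  have hM : 0 ≤ M₁ := by
    have := (abs_nonneg _).trans (hf 1 (by simp) 0 (by simp))
    simpa using this
  have hNpos : (0 : ℝ) < N := by positivity
  have hN3 : (3 : ℝ) ≤ N := by exact_mod_cast hN
  have hlog : 0 < log N := log_pos (by linarith)
  have hle : ∀ i j, i ≤ j → j ≤ N → t i ≤ t j := by
    intro i j hij
    induction j, hij using Nat.le_induction with
    | base => intro _; exact le_rfl
    | succ j _ ih => intro hj; exact (ih (by omega)).trans (hmono j (by omega)).le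
  have hnode : ∀ k ≤ N, t k ∈ Set.Icc (-1 : ℝ) 1 := fun k hk =>
    ⟨ht0 ▸ hle 0 k (Nat.zero_le k) hk, htN ▸ hle k N hk le_rfl⟩
  have hSL : ∀ u ∈ Set.Icc (-1 : ℝ) 1, ∀ v ∈ Set.Icc (-1 : ℝ) 1,
      |S u - S v| ≤ M₁ * |u - v| := by
    have h := abs_sub_le_of_grid hmono fun k hk => abs_linearInterp_sub_le (hmono k hk)
      (hf _ (hnode k hk.le) _ (hnode (k + 1) hk)) (hS k hk)
    rw [ht0, htN] at h
    intro u hu v hv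
    rcases le_total u v with huv | huv
    · rw [abs_sub_comm u v, abs_of_nonneg (sub_nonneg.2 huv)]
      exact h u hu v hv huv
    · rw [abs_sub_comm (S u), abs_of_nonneg (sub_nonneg.2 huv)]
      exact h v hv u hu huv
  have hsup : ∀ u ∈ Set.Icc (-1 : ℝ) 1, |f u - S u| ≤ M₁ * (γ / N) / 2 := by
    intro u hu
    obtain ⟨k, hk, hku⟩ := exists_mem_Icc_of_grid (t := t) (n := N) (u := u) (by omega)
      (by rwa [ht0, htN])
    rw [hS k hk u hku]
    refine (abs_sub_linearInterp_le (hmono k hk) hM hku (hf _ hu _ (hnode k hk.le))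
      (hf _ hu _ (hnode (k + 1) hk))).trans ?_
    have := hstep k hk
    gcongr
  have hgL : ∀ u ∈ Set.Icc (-1 : ℝ) 1, ∀ v ∈ Set.Icc (-1 : ℝ) 1,
      |(f u - S u) - (f v - S v)| ≤ 2 * M₁ * |u - v| := by
    intro u hu v hv
    rw [sub_sub_sub_comm]
    linarith [abs_sub (f u - f v) (S u - S v), hf u hu v hv, hSL u hu v hv]
  have hx' : x ∈ Set.Icc (-1 : ℝ) 1 := ⟨hx.1.le, hx.2.le⟩
  have hcont : ContinuousOn (fun u => f u - S u) (Set.Icc (-1) 1) := by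
    refine (LipschitzOnWith.of_dist_le_mul (K := (2 * M₁).toNNReal) fun u hu v hv => ?_).continuousOn
    rw [coe_toNNReal _ (by positivity)]
    exact hgL u hu v hv
  refine ⟨_, tendsto_airfoil_integral hx hcont fun u hu => hgL u hu x hx', ?_⟩
  have hmain := abs_mul_integral_airfoil_quotient_le (C := M₁ * (γ / N)) (δ := 2 / N) hx hcont
    (by positivity) (fun u hu => hgL u hu x hx')
    (fun u hu => by
      linarith [abs_sub (f u - S u) (f x - S x), hsup u hu, hsup x hx'])
    (by positivity) (by rw [div_le_iff₀ hNpos]; linarith)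
  rw [div_div_cancel₀ two_ne_zero] at hmain
  rw [div_mul_eq_mul_div, abs_div, abs_of_pos pi_pos, div_le_iff₀ pi_pos]
  refine hmain.trans ?_
  have e : 2 * γ * M₁ / π * (1 + 12 * π / (γ * log N)) * log N / N * π
      = 2 * (M₁ * (γ / N)) * log N + 24 * π * M₁ / N := by
    field_simp
    ring
  rw [e]
  have e2 : 2 * π * (2 * M₁) * (2 / N) = 8 * π * M₁ / N := by ring
  rw [e2]
  gcongr
  norm_num
end
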